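/- Let φ be a rational inner function on the polydisc 𝔻ⁿ, written φ = p/q with p, q ∈ ℂ[z₁,…,zₙ] having no common nonconstant polynomial factor and q zero-free on 𝔻ⁿ, and let α ∈ 𝕋. Let φ₁⁻¹(α) := {ζ ∈ 𝕋ⁿ : lim_{ρ→1⁻} φ(ρζ) exists and equals α}. Then the closure of φ₁⁻¹(α) in ℂⁿ equals V_α := {ζ ∈ 𝕋ⁿ : p(ζ) = α·q(ζ)}, the Hausdorff dimension of V_α is n − 1, and ℋ^{n−1}(V_α) > 0. -/

import Mathlib

open MeasureTheory Filter Set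
open scoped ENNReal

noncomputable section

/-- We endow finite-dimensional complex Euclidean spaces with their Borel σ-algebra. -/
instance {ι : Type*} [Fintype ι] : MeasurableSpace (EuclideanSpace ℂ ι) := borel _
instance {ι : Type*} [Fintype ι] : BorelSpace (EuclideanSpace ℂ ι) := ⟨rfl⟩

/-- Evaluation of a polynomial in the variables `ι` at a point of `ℂ^ι`. -/
def pEval {ι : Type*} (p : MvPolynomial ι ℂ) (z : EuclideanSpace ℂ ι) : ℂ :=
  MvPolynomial.eval (fun i => z i) p

/-- The open unit polydisc `𝔻ⁿ` in `ℂⁿ`. -/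
def polydisc (n : ℕ) : Set (EuclideanSpace ℂ (Fin n)) := {z | ∀ j, ‖z j‖ < 1}

/-- The unit torus `𝕋^ι` in `ℂ^ι`. -/
def torus (ι : Type*) : Set (EuclideanSpace ℂ ι) := {ζ | ∀ j, ‖ζ j‖ = 1}

/-- `φ` has radial limit `α` at `ζ`: `φ(ρζ) → α` as `ρ → 1⁻`. -/
def HasRadialLimit {n : ℕ} (φ : EuclideanSpace ℂ (Fin n) → ℂ)
    (ζ : EuclideanSpace ℂ (Fin n)) (α : ℂ) : Prop :=
  Tendsto (fun ρ : ℝ => φ ((ρ : ℂ) • ζ)) (nhdsWithin 1 (Set.Iio 1)) (nhds α)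

/-- `φ` is the rational inner function `p/q` on the polydisc `𝔻ⁿ`: `p, q` have no common
nonconstant factor, `q` is zero-free on `𝔻ⁿ`, `|φ| < 1` on `𝔻ⁿ`, and for a.e. `ζ ∈ 𝕋ⁿ`
(w.r.t. the Haar measure of `𝕋ⁿ`, i.e. up to an `ℋⁿ`-null set) the radial limit of `φ` at `ζ`
exists and is unimodular. -/
structure IsRationalInner (n : ℕ) (p q : MvPolynomial (Fin n) ℂ)
    (φ : EuclideanSpace ℂ (Fin n) → ℂ) : Prop where
  coprime : ∀ d : MvPolynomial (Fin n) ℂ, d ∣ p → d ∣ q → IsUnit d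
  q_ne_zero : ∀ z ∈ polydisc n, pEval q z ≠ 0
  phi_eq : ∀ z ∈ polydisc n, φ z = pEval p z / pEval q z
  abs_lt_one : ∀ z ∈ polydisc n, ‖φ z‖ < 1
  inner : ∃ E ⊆ torus (Fin n), μH[(n : ℝ)] E = 0 ∧
    ∀ ζ ∈ torus (Fin n) \ E, ∃ β : ℂ, ‖β‖ = 1 ∧ HasRadialLimit φ ζ β

/-- `μ` is a Clark measure of `φ` at `α`: a finite positive Borel measure on `𝕋ⁿ` whose
Poisson–Szegő integral is `(1-|φ|²)/|α-φ|²`. -/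
def IsClarkMeasure (n : ℕ) (φ : EuclideanSpace ℂ (Fin n) → ℂ) (α : ℂ)
    (μ : Measure (EuclideanSpace ℂ (Fin n))) : Prop :=
  IsFiniteMeasure μ ∧ μ (torus (Fin n))ᶜ = 0 ∧
    ∀ z ∈ polydisc n,
      ∫⁻ ζ, ENNReal.ofReal (∏ j, (1 - ‖z j‖ ^ 2) / ‖ζ j - z j‖ ^ 2) ∂μ
        = ENNReal.ofReal ((1 - ‖φ z‖ ^ 2) / ‖α - φ z‖ ^ 2)

/-- The subset of `L²(μ)` consisting of (classes of) holomorphic polynomial functions;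
`H²(μ)` is its closure in `L²(μ)`. -/
def polyLp (n : ℕ) (μ : Measure (EuclideanSpace ℂ (Fin n))) : Set (Lp ℂ 2 μ) :=
  {f | ∃ p : MvPolynomial (Fin n) ℂ, ⇑f =ᵐ[μ] pEval p}

/-- `φ₁⁻¹(α)`: the set of `ζ ∈ 𝕋ⁿ` where the radial limit of `φ` exists and equals `α`. -/
def radialFiber {n : ℕ} (φ : EuclideanSpace ℂ (Fin n) → ℂ) (α : ℂ) :
    Set (EuclideanSpace ℂ (Fin n)) :=
  {ζ | ζ ∈ torus (Fin n) ∧ HasRadialLimit φ ζ α}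

/-- The common zero set in `ℂ^ι` of a finite family of real polynomials in the real and
imaginary parts of the coordinates. -/
def realZeroSet {ι : Type*} (s : Finset (MvPolynomial (ι × Bool) ℝ)) :
    Set (EuclideanSpace ℂ ι) :=
  {w | ∀ P ∈ s, MvPolynomial.eval (fun ib => if ib.2 then (w ib.1).re else (w ib.1).im) P = 0}

/-- The projection `ℂⁿ → ℂ^{n-1}` deleting the `j`-th coordinate. -/
def deleteCoord {n : ℕ} (j : Fin n) (ζ : EuclideanSpace ℂ (Fin n)) :
    EuclideanSpace ℂ {i : Fin n // i ≠ j} :=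
  (WithLp.equiv 2 _).symm fun i => ζ i.1

open Polynomial in
/-- Two polynomials over a unique factorization domain that are not coprime over the fraction field
have a common divisor of positive degree. -/
theorem exists_common_dvd_of_not_isCoprime_map {A : Type*} [CommRing A] [IsDomain A]
    [UniqueFactorizationMonoid A] {f g : A[X]} (hg : g ≠ 0)
    (h : ¬ IsCoprime (f.map (algebraMap A (FractionRing A)))
      (g.map (algebraMap A (FractionRing A)))) :
    ∃ d : A[X], 0 < d.natDegree ∧ d ∣ f ∧ d ∣ g := by
  classical
  set K := FractionRing A
  have : NormalizedGCDMonoid A := Nonempty.some inferInstance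
  have hinj : Function.Injective (algebraMap A K) := IsFractionRing.injective A K
  rw [← EuclideanDomain.gcd_isUnit_iff] at h
  set e := EuclideanDomain.gcd (f.map (algebraMap A K)) (g.map (algebraMap A K)) with he
  have hgK : g.map (algebraMap A K) ≠ 0 := by
    rwa [Ne, Polynomial.map_eq_zero_iff hinj]
  have he0 : e ≠ 0 := by
    intro h0
    exact hgK (EuclideanDomain.gcd_eq_zero_iff.1 h0).2
  obtain ⟨b, hb, hbe⟩ := IsLocalization.integerNormalization_spec (nonZeroDivisors A) e
  set e' := IsLocalization.integerNormalization (nonZeroDivisors A) e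
  have hb0 : algebraMap A K b ≠ 0 := by
    rw [Ne, map_eq_zero_iff _ hinj]; exact nonZeroDivisors.ne_zero hb
  have hmap : e'.map (algebraMap A K) = C (algebraMap A K b) * e := by
    rw [hbe, Algebra.smul_def, Polynomial.algebraMap_apply]
  have hdvd : e'.primPart.map (algebraMap A K) ∣ e := by
    have h1 : e'.primPart.map (algebraMap A K) ∣ e'.map (algebraMap A K) :=
      Polynomial.map_dvd _ e'.primPart_dvd
    rw [hmap] at h1
    exact (IsUnit.dvd_mul_left (Polynomial.isUnit_C.2 hb0.isUnit)).1 h1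
  refine ⟨e'.primPart, ?_, ?_, ?_⟩
  · rw [natDegree_primPart, ← natDegree_map_eq_of_injective hinj, hmap, natDegree_C_mul hb0]
    rw [Nat.pos_iff_ne_zero]
    intro h0
    exact h (Polynomial.isUnit_iff_degree_eq_zero.2 (by
      rw [degree_eq_natDegree he0, h0]; rfl))
  · exact e'.isPrimitive_primPart.dvd_of_fraction_map_dvd_fraction_map (K := K)
      (hdvd.trans (EuclideanDomain.gcd_dvd_left _ _))
  · exact e'.isPrimitive_primPart.dvd_of_fraction_map_dvd_fraction_map (K := K)
      (hdvd.trans (EuclideanDomain.gcd_dvd_right _ _))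

open Polynomial in
/-- Two polynomials over a unique factorization domain, one of them nonzero, that have no common
divisor of positive degree have a nonzero constant in the ideal they generate. -/
theorem exists_mul_add_mul_eq_C_of_forall_dvd {A : Type*} [CommRing A] [IsDomain A]
    [UniqueFactorizationMonoid A] {f g : A[X]} (hg : g ≠ 0)
    (h : ∀ d : A[X], d ∣ f → d ∣ g → d.natDegree = 0) :
    ∃ (r : A) (a b : A[X]), r ≠ 0 ∧ f * a + g * b = C r := by
  by_cases hd : f.natDegree ≠ 0 ∨ g.natDegree ≠ 0
  · obtain ⟨a, b, -, -, hab⟩ := exists_mul_add_mul_eq_C_resultant f g le_rfl le_rfl hd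
    refine ⟨_, a, b, ?_, hab⟩
    intro h0
    have hinj : Function.Injective (algebraMap A (FractionRing A)) :=
      IsFractionRing.injective A _
    have h1 := resultant_map_map f g f.natDegree g.natDegree (algebraMap A (FractionRing A))
    rw [h0, map_zero] at h1
    have h2 : resultant (f.map (algebraMap A (FractionRing A)))
        (g.map (algebraMap A (FractionRing A))) = 0 := by
      rw [natDegree_map_eq_of_injective hinj, natDegree_map_eq_of_injective hinj]
      exact h1
    obtain ⟨d, hd0, hdf, hdg⟩ :=
      exists_common_dvd_of_not_isCoprime_map hg (resultant_eq_zero_iff.1 h2).2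
    exact hd0.ne' (h d hdf hdg)
  · push Not at hd
    refine ⟨g.coeff 0, 0, 1, ?_, ?_⟩
    · intro h0
      apply hg
      rw [eq_C_of_natDegree_eq_zero hd.2, h0, C_0]
    · rw [mul_zero, zero_add, mul_one]
      exact eq_C_of_natDegree_eq_zero hd.2

/-- The polynomial `λ ↦ p(λ z)` with coefficients polynomials in `z`. -/
def diagPoly {ι : Type*} (p : MvPolynomial ι ℂ) : Polynomial (MvPolynomial ι ℂ) :=
  MvPolynomial.aeval (fun i => Polynomial.C (MvPolynomial.X i) * Polynomial.X) p

theorem eval_C_diagPoly {ι : Type*} (p : MvPolynomial ι ℂ) (s : ℂ) :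
    (diagPoly p).eval (MvPolynomial.C s) =
      MvPolynomial.aeval (fun i => MvPolynomial.X i * MvPolynomial.C s) p := by
  have : (Polynomial.aeval (MvPolynomial.C s : MvPolynomial ι ℂ)).toRingHom.comp
        (MvPolynomial.aeval (R := ℂ)
          (fun i => Polynomial.C (MvPolynomial.X i : MvPolynomial ι ℂ) * Polynomial.X)).toRingHom
      = (MvPolynomial.aeval
          (fun i => (MvPolynomial.X i * MvPolynomial.C s : MvPolynomial ι ℂ))).toRingHom := by
    ext <;> simp [IsScalarTower.algebraMap_apply ℂ (MvPolynomial ι ℂ)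
      (Polynomial (MvPolynomial ι ℂ))]
  have h := congrArg (fun φ => φ p) this
  simpa [diagPoly, Polynomial.aeval_def, Polynomial.eval₂_eq_eval_map] using h

theorem diagPoly_common_dvd_natDegree {ι : Type*} {p q : MvPolynomial ι ℂ}
    (hcop : ∀ d : MvPolynomial ι ℂ, d ∣ p → d ∣ q → IsUnit d)
    (hq : MvPolynomial.eval 0 q ≠ 0)
    (d : Polynomial (MvPolynomial ι ℂ)) (hdp : d ∣ diagPoly p) (hdq : d ∣ diagPoly q) :
    d.natDegree = 0 := by
  have hunit : ∀ s : ℂ, IsUnit (d.eval (MvPolynomial.C s)) := by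
    intro s
    have h1 := Polynomial.eval_dvd (x := (MvPolynomial.C s : MvPolynomial ι ℂ)) hdp
    have h2 := Polynomial.eval_dvd (x := (MvPolynomial.C s : MvPolynomial ι ℂ)) hdq
    rw [eval_C_diagPoly] at h1 h2
    by_cases hs : s = 0
    · subst hs
      have h3 : MvPolynomial.aeval (fun i => MvPolynomial.X i * MvPolynomial.C (0 : ℂ)) q
          = MvPolynomial.C (σ := ι) (MvPolynomial.eval 0 q) := by
        have h0 : (fun i : ι => (MvPolynomial.X i * MvPolynomial.C (0 : ℂ) : MvPolynomial ι ℂ))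
          = (fun i => MvPolynomial.C ((0 : ι → ℂ) i)) := by
          funext i; simp
        rw [h0]
        have := MvPolynomial.aeval_algebraMap_apply (MvPolynomial ι ℂ) (0 : ι → ℂ) q
        simpa [MvPolynomial.algebraMap_eq, MvPolynomial.coe_aeval_eq_eval, Pi.zero_def,
          Function.comp_def] using this
      rw [h3] at h2
      exact isUnit_of_dvd_unit h2 (hq.isUnit.map MvPolynomial.C)
    · have hscale : ∀ t : ℂ, t * s = 1 → ∀ f : MvPolynomial ι ℂ,
          MvPolynomial.aeval (fun i => MvPolynomial.X i * MvPolynomial.C t)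
          (MvPolynomial.aeval (fun i => MvPolynomial.X i * MvPolynomial.C s) f :
            MvPolynomial ι ℂ) = f := by
        intro t ht f
        rw [← AlgHom.comp_apply, MvPolynomial.comp_aeval]
        conv_rhs => rw [← MvPolynomial.aeval_X_left_apply f]
        congr 2
        funext i
        simp only [map_mul, MvPolynomial.aeval_X, MvPolynomial.algHom_C,
          MvPolynomial.algebraMap_eq]
        rw [mul_assoc, ← map_mul, ht, map_one, mul_one]
      have hu : IsUnit (MvPolynomial.aeval
          (fun i => (MvPolynomial.X i * MvPolynomial.C s⁻¹ : MvPolynomial ι ℂ))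
          (d.eval (MvPolynomial.C s))) := by
        apply hcop
        · rw [← hscale s⁻¹ (inv_mul_cancel₀ hs) p]; exact map_dvd _ h1
        · rw [← hscale s⁻¹ (inv_mul_cancel₀ hs) q]; exact map_dvd _ h2
      obtain ⟨c, hc, hce⟩ := MvPolynomial.isUnit_iff_eq_C_of_isReduced.1 hu
      have h5 := congrArg (MvPolynomial.aeval
          (fun i => (MvPolynomial.X i * MvPolynomial.C s : MvPolynomial ι ℂ))) hce
      have h6 : MvPolynomial.aeval (fun i => MvPolynomial.X i * MvPolynomial.C s)
          (MvPolynomial.aeval (fun i => MvPolynomial.X i * MvPolynomial.C s⁻¹)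
            (d.eval (MvPolynomial.C s)) :
            MvPolynomial ι ℂ) = d.eval (MvPolynomial.C s) := by
        rw [← AlgHom.comp_apply, MvPolynomial.comp_aeval]
        conv_rhs => rw [← MvPolynomial.aeval_X_left_apply (d.eval (MvPolynomial.C s))]
        congr 2
        funext i
        simp only [map_mul, MvPolynomial.aeval_X, MvPolynomial.algHom_C,
          MvPolynomial.algebraMap_eq]
        rw [mul_assoc, ← map_mul, mul_inv_cancel₀ hs, map_one, mul_one]
      rw [h6] at h5
      rw [h5]
      simpa using hc
  choose c hc hce using fun s => MvPolynomial.isUnit_iff_eq_C_of_isReduced.1 (hunit s)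
  have hd0 : ∀ s, (d.map (MvPolynomial.eval (0 : ι → ℂ))).eval s = c s := by
    intro s
    have := Polynomial.eval_map_apply (MvPolynomial.eval (0 : ι → ℂ)) (MvPolynomial.C s) (p := d)
    rw [hce s] at this
    simpa using this
  have hdeg : (d.map (MvPolynomial.eval (0 : ι → ℂ))).degree ≤ 0 := by
    by_contra hlt
    push Not at hlt
    obtain ⟨s, hs⟩ := IsAlgClosed.exists_root _ hlt.ne'
    rw [Polynomial.IsRoot, hd0] at hs
    exact (hc s).ne_zero hs
  have hconst : ∀ s, c s = c 0 := by
    intro s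
    rw [← hd0, ← hd0, Polynomial.eq_C_of_degree_le_zero hdeg]
    simp
  have hdC : d = Polynomial.C (MvPolynomial.C (c 0)) := by
    rw [← sub_eq_zero]
    apply Polynomial.eq_zero_of_infinite_isRoot
    refine (Set.infinite_range_of_injective (MvPolynomial.C_injective ι ℂ)).mono ?_
    rintro _ ⟨s, rfl⟩
    simp [hce, hconst s]
  rw [hdC, Polynomial.natDegree_C]

theorem diagPoly_ne_zero {ι : Type*} {q : MvPolynomial ι ℂ}
    (hq : MvPolynomial.eval 0 q ≠ 0) : diagPoly q ≠ 0 := by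
  intro h
  have h1 := eval_C_diagPoly q 1
  rw [h] at h1
  simp at h1
  rw [← h1] at hq
  simp at hq
/-- The reflection `z ^ N * conj (p (1 / conj z))` of a polynomial `p` whose exponents are at most
`N`. -/
def reflectPoly {ι : Type*} (N : ι →₀ ℕ) (p : MvPolynomial ι ℂ) : MvPolynomial ι ℂ :=
  ∑ m ∈ p.support, MvPolynomial.monomial (N - m) (starRingEnd ℂ (p.coeff m))

theorem eval_reflectPoly {ι : Type*} [Fintype ι] {N : ι →₀ ℕ} {p : MvPolynomial ι ℂ}
    (hN : ∀ m ∈ p.support, m ≤ N) {z : ι → ℂ} (hz : ∀ i, z i ≠ 0) :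
    MvPolynomial.eval z (reflectPoly N p) = (∏ i, z i ^ N i) *
      starRingEnd ℂ (MvPolynomial.eval (fun i => (starRingEnd ℂ (z i))⁻¹) p) := by
  rw [reflectPoly, map_sum, MvPolynomial.eval_eq', map_sum, Finset.mul_sum]
  refine Finset.sum_congr rfl fun m hm => ?_
  have hm' := hN m hm
  rw [MvPolynomial.eval_monomial, Finsupp.prod_fintype _ _ (by simp), map_mul, map_prod,
    mul_left_comm, ← Finset.prod_mul_distrib]
  congr 1
  refine Finset.prod_congr rfl fun i _ => ?_
  rw [Finsupp.tsub_apply, pow_sub₀ _ (hz i) (hm' i), map_pow, map_inv₀, Complex.conj_conj, inv_pow]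

/-- A numerator of modulus smaller than that of the coprime denominator on the polydisc and equal to
it on the torus never takes the value `α q` with `‖α‖ = 1` on the exterior polydisc. -/
theorem eval_ne_mul_eval_of_one_lt_norm {ι : Type*} [Fintype ι] {p q : MvPolynomial ι ℂ}
    (hcop : ∀ d : MvPolynomial ι ℂ, d ∣ p → d ∣ q → IsUnit d)
    (hlt : ∀ z : ι → ℂ, (∀ i, ‖z i‖ < 1) → ‖MvPolynomial.eval z p‖ < ‖MvPolynomial.eval z q‖)
    (hT : ∀ z : ι → ℂ, (∀ i, ‖z i‖ = 1) → ‖MvPolynomial.eval z p‖ = ‖MvPolynomial.eval z q‖)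
    {α : ℂ} (hα : ‖α‖ = 1) {z : ι → ℂ} (hz : ∀ i, 1 < ‖z i‖) :
    MvPolynomial.eval z p ≠ α * MvPolynomial.eval z q := by
  classical
  set N : ι →₀ ℕ := p.support.sup id ⊔ q.support.sup id with hNdef
  have hNp : ∀ m ∈ p.support, m ≤ N := fun m hm =>
    (Finset.le_sup (f := id) hm).trans le_sup_left
  have hNq : ∀ m ∈ q.support, m ≤ N := fun m hm =>
    (Finset.le_sup (f := id) hm).trans le_sup_right
  have hid : p * reflectPoly N p = q * reflectPoly N q := by
    have hinf : ∀ _ : ι, (Metric.sphere (0 : ℂ) 1).Infinite := fun _ =>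
      (isPreconnected_sphere (by simp) (0 : ℂ) 1).infinite_of_nontrivial
        ⟨1, by simp, -1, by simp, by norm_num⟩
    refine MvPolynomial.funext_set _ hinf fun x hx => ?_
    have hx1 : ∀ i, ‖x i‖ = 1 := fun i => by simpa using hx i trivial
    have hx0 : ∀ i, x i ≠ 0 := fun i h => by simpa [h] using hx1 i
    have hxx : (fun i => (starRingEnd ℂ (x i))⁻¹) = x := by
      funext i
      rw [← Complex.inv_eq_conj (hx1 i), inv_inv]
    rw [map_mul, map_mul, eval_reflectPoly hNp hx0, eval_reflectPoly hNq hx0, hxx,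
      mul_left_comm, mul_left_comm (MvPolynomial.eval x q), Complex.mul_conj', Complex.mul_conj',
      hT x hx1]
  have hz0 : ∀ i, z i ≠ 0 := fun i h => by
    have := hz i
    rw [h, norm_zero] at this
    linarith
  set w : ι → ℂ := fun i => (starRingEnd ℂ (z i))⁻¹ with hw
  have hw1 : ∀ i, ‖w i‖ < 1 := fun i => by
    simp only [hw, norm_inv, RCLike.norm_conj]
    exact inv_lt_one_of_one_lt₀ (hz i)
  have hprod : (∏ i, z i ^ N i) ≠ 0 :=
    Finset.prod_ne_zero_iff.2 fun i _ => pow_ne_zero _ (hz0 i)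
  have hpne : MvPolynomial.eval z p ≠ 0 := by
    intro h0
    have hdvd : p ∣ reflectPoly N q :=
      IsRelPrime.dvd_of_dvd_mul_left (fun d => hcop d) ⟨_, hid.symm⟩
    obtain ⟨c, hc⟩ := hdvd
    have h1 := congrArg (MvPolynomial.eval z) hc
    rw [map_mul, h0, zero_mul, eval_reflectPoly hNq hz0] at h1
    have h2 : MvPolynomial.eval w q = 0 := by
      simpa [hprod] using h1
    have h3 := hlt w hw1
    rw [h2, norm_zero] at h3
    exact absurd h3 (not_lt.2 (norm_nonneg _))
  intro heq
  have h1 := congrArg (MvPolynomial.eval z) hid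
  rw [map_mul, map_mul, eval_reflectPoly hNp hz0, eval_reflectPoly hNq hz0,
    mul_left_comm, mul_left_comm (MvPolynomial.eval z q)] at h1
  have h2 := congrArg norm (mul_left_cancel₀ hprod h1)
  rw [norm_mul, norm_mul, RCLike.norm_conj, RCLike.norm_conj] at h2
  have h3 : ‖MvPolynomial.eval z p‖ = ‖MvPolynomial.eval z q‖ := by
    rw [heq, norm_mul, hα, one_mul]
  rw [h3] at h2
  have h4 : ‖MvPolynomial.eval z q‖ ≠ 0 := by
    rw [← h3]; exact norm_ne_zero_iff.2 hpne
  exact (hlt w hw1).ne (mul_left_cancel₀ h4 h2)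

/-- The one-variable polynomial `λ ↦ p(λ ω)`. -/
def slicePoly {ι : Type*} (p : MvPolynomial ι ℂ) (ω : ι → ℂ) : Polynomial ℂ :=
  (diagPoly p).map (MvPolynomial.eval ω)

theorem eval_slicePoly {ι : Type*} (p : MvPolynomial ι ℂ) (ω : ι → ℂ) (s : ℂ) :
    (slicePoly p ω).eval s = MvPolynomial.eval (s • ω) p := by
  have h := Polynomial.eval_map_apply (MvPolynomial.eval ω) (MvPolynomial.C s) (p := diagPoly p)
  rw [MvPolynomial.eval_C, eval_C_diagPoly] at h
  rw [slicePoly, h]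
  have h2 : (MvPolynomial.aeval (R := ℂ) ω).comp
      (MvPolynomial.aeval (fun i => (MvPolynomial.X i * MvPolynomial.C s : MvPolynomial ι ℂ)))
      = MvPolynomial.aeval (s • ω) := by
    ext i
    simp [mul_comm]
  have h3 := DFunLike.congr_fun h2 p
  simpa [MvPolynomial.coe_aeval_eq_eval] using h3

/-- A polynomial all of whose roots are unimodular and whose value at `1` is small compared to its
value at `0` has a root close to `1`. -/
theorem exists_root_near_one {g : Polynomial ℂ} {D : ℕ} (hD : g.natDegree ≤ D)
    (hroots : ∀ s, g.eval s = 0 → ‖s‖ = 1) {ε : ℝ} (hε : 0 < ε) (hε1 : ε ≤ 1)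
    (hsmall : ‖g.eval 1‖ < ε ^ D * ‖g.eval 0‖) : ∃ s, g.eval s = 0 ∧ ‖1 - s‖ < ε := by
  by_contra! hcon
  have hg0 : g ≠ 0 := by
    rintro rfl
    simp at hsmall
  have hsp : g.Splits := IsAlgClosed.splits g
  have hnorm : ∀ x, ‖g.eval x‖ = ‖g.leadingCoeff‖ * (g.roots.map fun a => ‖x - a‖).prod := by
    intro x
    rw [hsp.eval_eq_prod_roots, norm_mul]
    congr 1
    simpa [Multiset.map_map, Function.comp_def] using
      map_multiset_prod (normHom : ℂ →*₀ ℝ) (g.roots.map fun a => x - a)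
  have h0 : ‖g.eval 0‖ = ‖g.leadingCoeff‖ := by
    rw [hnorm, Multiset.prod_eq_one, mul_one]
    intro x hx
    obtain ⟨a, ha, rfl⟩ := Multiset.mem_map.1 hx
    rw [zero_sub, norm_neg]
    exact hroots a (Polynomial.isRoot_of_mem_roots ha)
  have h1 : ε ^ D ≤ (g.roots.map fun a => ‖1 - a‖).prod := by
    calc ε ^ D ≤ ε ^ g.roots.card :=
          pow_le_pow_of_le_one hε.le hε1 ((Polynomial.card_roots' g).trans hD)
      _ = (g.roots.map fun _ => ε).prod := by simp
      _ ≤ _ := by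
          refine Multiset.prod_map_le_prod_map₀ _ _ (fun _ _ => hε.le) fun a ha => ?_
          exact hcon a (Polynomial.isRoot_of_mem_roots ha)
  rw [h0, hnorm 1, mul_comm] at hsmall
  exact absurd hsmall (not_lt.2 (mul_le_mul_of_nonneg_right h1 (norm_nonneg _)))

section InnerPair

variable {ι : Type*} {p q : MvPolynomial ι ℂ} {α : ℂ}

theorem eval_sub_ne_zero_of_norm_lt_one
    (hlt : ∀ z : ι → ℂ, (∀ i, ‖z i‖ < 1) → ‖MvPolynomial.eval z p‖ < ‖MvPolynomial.eval z q‖)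
    (hα : ‖α‖ = 1) {z : ι → ℂ} (hz : ∀ i, ‖z i‖ < 1) :
    MvPolynomial.eval z (p - MvPolynomial.C α * q) ≠ 0 := by
  intro h
  rw [map_sub, map_mul, MvPolynomial.eval_C, sub_eq_zero] at h
  have := hlt z hz
  rw [h, norm_mul, hα, one_mul] at this
  exact lt_irrefl _ this

variable [Fintype ι]

theorem norm_eq_one_of_eval_slicePoly_eq_zero
    (hcop : ∀ d : MvPolynomial ι ℂ, d ∣ p → d ∣ q → IsUnit d)
    (hlt : ∀ z : ι → ℂ, (∀ i, ‖z i‖ < 1) → ‖MvPolynomial.eval z p‖ < ‖MvPolynomial.eval z q‖)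
    (hT : ∀ z : ι → ℂ, (∀ i, ‖z i‖ = 1) → ‖MvPolynomial.eval z p‖ = ‖MvPolynomial.eval z q‖)
    (hα : ‖α‖ = 1) {ω : ι → ℂ} (hω : ∀ i, ‖ω i‖ = 1) {s : ℂ}
    (hs : (slicePoly (p - MvPolynomial.C α * q) ω).eval s = 0) : ‖s‖ = 1 := by
  rw [eval_slicePoly] at hs
  rcases lt_trichotomy ‖s‖ 1 with h | h | h
  · refine absurd hs (eval_sub_ne_zero_of_norm_lt_one hlt hα fun i => ?_)
    simpa [hω i] using h
  · exact h
  · rw [map_sub, map_mul, MvPolynomial.eval_C, sub_eq_zero] at hs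
    refine absurd hs (eval_ne_mul_eval_of_one_lt_norm hcop hlt hT hα fun i => ?_)
    simpa [hω i] using h

/-- Every diagonal slice of the torus meets the level set `p = α q`. -/
theorem exists_eval_smul_eq_zero
    (hcop : ∀ d : MvPolynomial ι ℂ, d ∣ p → d ∣ q → IsUnit d)
    (hlt : ∀ z : ι → ℂ, (∀ i, ‖z i‖ < 1) → ‖MvPolynomial.eval z p‖ < ‖MvPolynomial.eval z q‖)
    (hT : ∀ z : ι → ℂ, (∀ i, ‖z i‖ = 1) → ‖MvPolynomial.eval z p‖ = ‖MvPolynomial.eval z q‖)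
    (hα : ‖α‖ = 1) {ω : ι → ℂ} (hω : ∀ i, ‖ω i‖ = 1) :
    ∃ s : ℂ, ‖s‖ = 1 ∧ MvPolynomial.eval (s • ω) (p - MvPolynomial.C α * q) = 0 := by
  by_contra! hcon
  set g := slicePoly (p - MvPolynomial.C α * q) ω with hg
  set h := slicePoly q ω with hh
  have hdeg : g.degree ≤ 0 := by
    by_contra hlt'
    push Not at hlt'
    obtain ⟨s, hs⟩ := IsAlgClosed.exists_root _ hlt'.ne'
    have h1 := norm_eq_one_of_eval_slicePoly_eq_zero hcop hlt hT hα hω hs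
    exact hcon s h1 (by rw [← eval_slicePoly]; exact hs)
  obtain ⟨c, hc⟩ : ∃ c, g = Polynomial.C c := ⟨_, Polynomial.eq_C_of_degree_le_zero hdeg⟩
  have hgs : ∀ s : ℂ, MvPolynomial.eval (s • ω) p = α * MvPolynomial.eval (s • ω) q + c := by
    intro s
    have h1 := eval_slicePoly (p - MvPolynomial.C α * q) ω s
    rw [← hg, hc, Polynomial.eval_C, map_sub, map_mul, MvPolynomial.eval_C] at h1
    rw [h1]; ring
  have hc0 : c ≠ 0 := by
    rintro rfl
    have h1 := hlt 0 (by simp)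
    have h2 := hgs 0
    rw [zero_smul, add_zero] at h2
    rw [h2, norm_mul, hα, one_mul] at h1
    exact lt_irrefl _ h1
  have hhdeg : h.degree ≤ 0 := by
    by_contra hlt'
    push Not at hlt'
    obtain ⟨M, hM⟩ := (isCompact_sphere (0 : ℂ) 1).exists_bound_of_continuousOn
      (f := fun s => h.eval s) h.continuous.continuousOn
    -- choose a unimodular `β ≠ α` close to `α`
    have hev : ∀ᶠ t : ℝ in nhdsWithin 0 (Set.Ioi 0),
        ‖α * Complex.exp (t * Complex.I) - α‖ * (|M| + 1) < ‖c‖ := by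
      have hcont : Continuous fun t : ℝ =>
          ‖α * Complex.exp (t * Complex.I) - α‖ * (|M| + 1) := by fun_prop
      have := hcont.tendsto 0
      simp only [Complex.ofReal_zero, zero_mul, Complex.exp_zero, mul_one, sub_self,
        norm_zero] at this
      exact (this.eventually (gt_mem_nhds (norm_pos_iff.2 hc0))).filter_mono nhdsWithin_le_nhds
    obtain ⟨t, ht, ht0, htpi⟩ := (hev.and (Ioo_mem_nhdsGT Real.pi_pos)).exists
    set β := α * Complex.exp (t * Complex.I) with hβ
    have hβ1 : ‖β‖ = 1 := by rw [hβ, norm_mul, hα, Complex.norm_exp_ofReal_mul_I, one_mul]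
    have hβα : β - α ≠ 0 := by
      intro h0
      have hα0 : α ≠ 0 := norm_ne_zero_iff.1 (by rw [hα]; exact one_ne_zero)
      have h1 : Complex.exp (t * Complex.I) = 1 := by
        have : α * Complex.exp (t * Complex.I) = α * 1 := by
          rw [mul_one]; exact sub_eq_zero.1 h0
        exact mul_left_cancel₀ hα0 this
      have h2 := congrArg Complex.im h1
      rw [Complex.exp_ofReal_mul_I_im, Complex.one_im] at h2
      exact (Real.sin_pos_of_pos_of_lt_pi ht0 htpi).ne' h2
    obtain ⟨s, hs⟩ := IsAlgClosed.exists_root (h - Polynomial.C (c / (β - α))) (by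
      rw [Polynomial.degree_sub_C hlt']; exact hlt'.ne')
    have hs' : MvPolynomial.eval (s • ω) q = c / (β - α) := by
      rw [← eval_slicePoly]
      simpa [sub_eq_zero] using hs
    have hsn : ‖s‖ = 1 := by
      refine norm_eq_one_of_eval_slicePoly_eq_zero hcop hlt hT hβ1 hω (s := s) ?_
      rw [eval_slicePoly, map_sub, map_mul, MvPolynomial.eval_C, hgs, hs']
      field_simp
      ring
    have h3 := hM s (by simpa using hsn)
    rw [hh, eval_slicePoly, hs', norm_div, div_le_iff₀ (norm_pos_iff.2 hβα)] at h3
    have h4 : M * ‖β - α‖ ≤ ‖β - α‖ * (|M| + 1) := by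
      rw [mul_comm]
      exact mul_le_mul_of_nonneg_left (by linarith [le_abs_self M]) (norm_nonneg _)
    linarith
  have hq1 : MvPolynomial.eval ω q = MvPolynomial.eval 0 q := by
    have h1 := eval_slicePoly q ω 1
    have h0 := eval_slicePoly q ω 0
    rw [← hh, Polynomial.eq_C_of_degree_le_zero hhdeg, Polynomial.eval_C] at h0 h1
    rw [one_smul] at h1
    rw [zero_smul] at h0
    rw [← h1, ← h0]
  have h1 := hgs 1
  have h0 := hgs 0
  rw [one_smul, hq1] at h1
  rw [zero_smul, ← h1] at h0
  have h5 := hlt 0 (by simp)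
  rw [h0, hT ω hω, hq1] at h5
  exact lt_irrefl _ h5

/-- Near a point of the torus where `p - α q` is small, every diagonal slice meets the level set
`p = α q`. -/
theorem eventually_exists_eval_smul_eq_zero
    (hcop : ∀ d : MvPolynomial ι ℂ, d ∣ p → d ∣ q → IsUnit d)
    (hlt : ∀ z : ι → ℂ, (∀ i, ‖z i‖ < 1) → ‖MvPolynomial.eval z p‖ < ‖MvPolynomial.eval z q‖)
    (hT : ∀ z : ι → ℂ, (∀ i, ‖z i‖ = 1) → ‖MvPolynomial.eval z p‖ = ‖MvPolynomial.eval z q‖)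
    (hα : ‖α‖ = 1) {ζ : ι → ℂ} (hζ : MvPolynomial.eval ζ (p - MvPolynomial.C α * q) = 0)
    {ε : ℝ} (hε : 0 < ε) :
    ∀ᶠ ω in nhds ζ, (∀ i, ‖ω i‖ = 1) → ∃ s : ℂ, ‖s‖ = 1 ∧ ‖1 - s‖ < ε ∧
      MvPolynomial.eval (s • ω) (p - MvPolynomial.C α * q) = 0 := by
  set P := p - MvPolynomial.C α * q with hP
  have hP0 : MvPolynomial.eval 0 P ≠ 0 := eval_sub_ne_zero_of_norm_lt_one hlt hα (by simp)
  set D := (diagPoly P).natDegree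
  have hε' : 0 < min ε 1 := lt_min hε one_pos
  have hcont : Continuous fun ω : ι → ℂ => ‖MvPolynomial.eval ω P‖ :=
    (MvPolynomial.continuous_eval P).norm
  have htend := hcont.tendsto ζ
  rw [hζ, norm_zero] at htend
  filter_upwards [htend.eventually (gt_mem_nhds
    (mul_pos (pow_pos hε' D) (norm_pos_iff.2 hP0)))] with ω hω hω1
  obtain ⟨s, hs, hs1⟩ := exists_root_near_one (g := slicePoly P ω) (D := D)
    Polynomial.natDegree_map_le
    (fun s hs => norm_eq_one_of_eval_slicePoly_eq_zero hcop hlt hT hα hω1 hs)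
    hε' (min_le_right _ _) (by simpa [eval_slicePoly] using hω)
  exact ⟨s, norm_eq_one_of_eval_slicePoly_eq_zero hcop hlt hT hα hω1 hs,
    hs1.trans_le (min_le_left _ _), by rw [← eval_slicePoly]; exact hs⟩

end InnerPair
open Polynomial in
/-- Iterating `g ↦ X g'` on a nonzero polynomial eventually yields one that does not vanish
at `1`. -/
theorem exists_iterate_X_mul_derivative_eval_ne_zero {g : ℂ[X]} (hg : g ≠ 0) :
    ∃ k : ℕ, ((fun h : ℂ[X] => X * derivative h)^[k] g).eval 1 ≠ 0 := by
  induction hn : g.rootMultiplicity 1 generalizing g with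
  | zero =>
    refine ⟨0, fun h => ?_⟩
    exact (rootMultiplicity_pos hg).2 h |>.ne' hn
  | succ n ih =>
    have hroot : g.IsRoot 1 := (rootMultiplicity_pos hg).1 (by omega)
    have hd : derivative g ≠ 0 := by
      intro h0
      have h1 := derivative_eq_zero.1 h0
      rw [eq_C_of_natDegree_eq_zero h1, IsRoot, eval_C] at hroot
      apply hg
      rw [eq_C_of_natDegree_eq_zero h1, hroot, C_0]
    have hXd : X * derivative g ≠ 0 := mul_ne_zero X_ne_zero hd
    obtain ⟨k, hk⟩ := ih hXd (by
      rw [rootMultiplicity_mul hXd, derivative_rootMultiplicity_of_root hroot, hn,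
        rootMultiplicity_eq_zero (by simp)]
      omega)
    exact ⟨k + 1, hk⟩

/-- The derivative in the diagonal direction. -/
def diagDeriv {ι : Type*} [Fintype ι] (f : (ι → ℝ) → ℂ) : (ι → ℝ) → ℂ :=
  fun x => fderiv ℝ f x 1

theorem ContDiff.diagDeriv {ι : Type*} [Fintype ι] {f : (ι → ℝ) → ℂ}
    (hf : ContDiff ℝ (⊤ : ℕ∞) f) : ContDiff ℝ (⊤ : ℕ∞) (diagDeriv f) :=
  (hf.fderiv_right (m := (⊤ : ℕ∞)) (by simp)).clm_apply contDiff_const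

theorem ContDiff.iterate_diagDeriv {ι : Type*} [Fintype ι] {f : (ι → ℝ) → ℂ}
    (hf : ContDiff ℝ (⊤ : ℕ∞) f) (k : ℕ) : ContDiff ℝ (⊤ : ℕ∞) (_root_.diagDeriv^[k] f) := by
  induction k generalizing f with
  | zero => exact hf
  | succ k ih => exact ih hf.diagDeriv

open Polynomial in
/-- If `f` is along a diagonal line a polynomial in `exp (i t)`, then its iterated diagonal
derivatives are given by iterating `g ↦ X g'`. -/
theorem iterate_diagDeriv_eq {ι : Type*} [Fintype ι] {f : (ι → ℝ) → ℂ}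
    (hf : ContDiff ℝ (⊤ : ℕ∞) f) {x : ι → ℝ} {c : ℂ} (hc : c ≠ 0) {g : ℂ[X]}
    (hfg : ∀ t : ℝ, f (x + t • 1) = c * g.eval (Complex.exp (t * Complex.I))) (k : ℕ) :
    ∃ c' : ℂ, c' ≠ 0 ∧
      diagDeriv^[k] f x = c' * ((fun h : ℂ[X] => X * derivative h)^[k] g).eval 1 := by
  induction k generalizing f g c with
  | zero =>
    refine ⟨c, hc, ?_⟩
    simpa using hfg 0
  | succ k ih =>
    refine ih hf.diagDeriv (mul_ne_zero hc Complex.I_ne_zero) (g := X * derivative g) fun t => ?_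
    have hline : HasDerivAt (fun t : ℝ => x + t • (1 : ι → ℝ)) 1 t := by
      simpa using ((hasDerivAt_id t).smul_const (1 : ι → ℝ)).const_add x
    have h1 : HasDerivAt (fun t : ℝ => f (x + t • 1)) (diagDeriv f (x + t • 1)) t :=
      ((hf.differentiable (by simp)) _).hasFDerivAt.comp_hasDerivAt t hline
    have hexp : HasDerivAt (fun t : ℝ => Complex.exp (t * Complex.I))
        (Complex.exp (t * Complex.I) * Complex.I) t := by
      have := (((hasDerivAt_id (t : ℂ)).mul_const Complex.I).cexp).comp_ofReal
      simpa using this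
    have h2 := (HasDerivAt.scomp_of_eq t (g.hasDerivAt _) hexp rfl).const_mul c
    have h3 : (fun t : ℝ => f (x + t • 1)) =
        fun t : ℝ => c * ((fun s => g.eval s) ∘ fun t : ℝ => Complex.exp (t * Complex.I)) t :=
      funext hfg
    rw [h3] at h1
    rw [h1.unique h2, eval_mul, eval_X, smul_eq_mul]
    ring

/-- The regular part of the zero set of a smooth function, in the diagonal direction, has
codimension at least one. -/
theorem dimH_regular_zeros_le {m : ℕ} {u : (Fin (m + 1) → ℝ) → ℂ}
    (hu : ContDiff ℝ (⊤ : ℕ∞) u) : dimH {x | u x = 0 ∧ diagDeriv u x ≠ 0} ≤ m := by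
  by_contra hcon
  push Not at hcon
  obtain ⟨x, ⟨-, hx1⟩, hx⟩ := exists_mem_nhdsWithin_lt_dimH_of_lt_dimH hcon
  set S := {x | u x = 0 ∧ diagDeriv u x ≠ 0} with hS
  set u' := fderiv ℝ u x with hu'
  have hstrict : HasStrictFDerivAt u u' x := hu.contDiffAt.hasStrictFDerivAt (by simp)
  let π : (Fin (m + 1) → ℝ) →L[ℝ] (Fin m → ℝ) :=
    ContinuousLinearMap.pi fun j =>
      ContinuousLinearMap.proj (R := ℝ) (φ := fun _ : Fin (m + 1) => ℝ) j.succ -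
        ContinuousLinearMap.proj (R := ℝ) (φ := fun _ : Fin (m + 1) => ℝ) 0
  have hinj : LinearMap.ker ((u'.prod π : _ →L[ℝ] ℂ × (Fin m → ℝ)) :
      (Fin (m + 1) → ℝ) →ₗ[ℝ] ℂ × (Fin m → ℝ)) = ⊥ := by
    rw [LinearMap.ker_eq_bot']
    intro v hv
    have hv1 : u' v = 0 := congrArg Prod.fst hv
    have hv2 : π v = 0 := congrArg Prod.snd hv
    have hv3 : v = v 0 • (1 : Fin (m + 1) → ℝ) := by
      funext i
      refine Fin.cases (by simp) (fun j => ?_) i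
      have := congrFun hv2 j
      simpa [π, sub_eq_zero] using this
    rw [hv3, map_smul] at hv1
    have h0 : v 0 = 0 := by
      rcases smul_eq_zero.1 hv1 with h | h
      · exact h
      · exact absurd h hx1
    rw [hv3, h0, zero_smul]
  obtain ⟨K, hK, hanti⟩ := LinearMap.exists_antilipschitzWith _ hinj
  have hKpos : (0 : ℝ) < K := hK
  have hlittle := hstrict.isLittleO.def (c := 1 / (2 * K)) (by positivity)
  obtain ⟨U, hU, hUU⟩ := (Filter.eventually_prod_self_iff' (la := nhds x)
    (r := fun y => ‖u y.1 - u y.2 - u' (y.1 - y.2)‖ ≤ 1 / (2 * K) * ‖y.1 - y.2‖)).1 (by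
      rwa [← nhds_prod_eq])
  have hmem : S ∩ U ∈ nhdsWithin x S := Filter.inter_mem self_mem_nhdsWithin
    (mem_nhdsWithin_of_mem_nhds hU)
  refine absurd (hx _ hmem) (not_lt.2 ?_)
  have hdist : AntilipschitzWith K (fun y : ↥(S ∩ U) => π y) := by
    refine AntilipschitzWith.of_le_mul_dist fun y z => ?_
    have h1 := hUU y y.2.2 z z.2.2
    simp only [y.2.1.1, z.2.1.1, sub_zero, zero_sub, norm_neg] at h1
    have h2 := hanti.le_mul_dist (y : Fin (m + 1) → ℝ) z
    rw [dist_eq_norm, dist_eq_norm, ← map_sub] at h2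
    rw [Subtype.dist_eq, dist_eq_norm, dist_eq_norm, ← map_sub]
    set v := (y : Fin (m + 1) → ℝ) - z
    have h3 : ‖v‖ ≤ K * max ‖u' v‖ ‖π v‖ := h2
    rcases le_total ‖u' v‖ ‖π v‖ with h | h
    · rwa [max_eq_right h] at h3
    · rw [max_eq_left h] at h3
      have h4 : K * ‖u' v‖ ≤ ‖v‖ / 2 := by
        calc K * ‖u' v‖ ≤ K * (1 / (2 * K) * ‖v‖) := by gcongr
          _ = ‖v‖ / 2 := by field_simp
      have h5 : ‖v‖ ≤ 0 := by linarith
      exact h5.trans (by positivity)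
  have h1 := hdist.le_dimH_image Set.univ
  have h2 : dimH (Set.univ : Set ↥(S ∩ U)) = dimH (S ∩ U) := by
    rw [← (isometry_subtype_coe (s := S ∩ U)).dimH_image, Set.image_univ, Subtype.range_coe]
  rw [h2] at h1
  calc dimH (S ∩ U) ≤ _ := h1
    _ ≤ dimH (Set.univ : Set (Fin m → ℝ)) := dimH_mono (Set.subset_univ _)
    _ = m := Real.dimH_univ_pi_fin m

/-- The zero set on the torus of a polynomial with nonzero constant coefficient has codimension at
least one. -/
theorem dimH_torus_zeros_le {m : ℕ} {P : MvPolynomial (Fin (m + 1)) ℂ}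
    (hP : MvPolynomial.eval 0 P ≠ 0) :
    dimH {ζ | ζ ∈ torus (Fin (m + 1)) ∧ pEval P ζ = 0} ≤ m := by
  set e : (Fin (m + 1) → ℝ) → EuclideanSpace ℂ (Fin (m + 1)) :=
    fun x => WithLp.toLp 2 fun i => Complex.exp (x i * Complex.I) with he
  have hcoord : ∀ i, ContDiff ℝ (⊤ : ℕ∞) fun x : Fin (m + 1) → ℝ =>
      Complex.exp (x i * Complex.I) := fun i =>
    ((Complex.ofRealCLM.contDiff.comp (contDiff_apply ℝ ℝ i)).mul contDiff_const).cexp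
  have hsm : ContDiff ℝ 1 e := contDiff_piLp' 2 fun i => (hcoord i).of_le (by exact_mod_cast le_top)
  set f : (Fin (m + 1) → ℝ) → ℂ :=
    fun x => MvPolynomial.eval (fun i => Complex.exp (x i * Complex.I)) P with hf
  have hfsm : ContDiff ℝ (⊤ : ℕ∞) f := by
    simp only [hf, MvPolynomial.eval_eq']
    exact ContDiff.sum fun d _ => contDiff_const.mul
      (contDiff_prod fun i _ => (hcoord i).pow _)
  have hsub : {ζ | ζ ∈ torus (Fin (m + 1)) ∧ pEval P ζ = 0} ⊆
      e '' ⋃ k : ℕ, {x | diagDeriv^[k] f x = 0 ∧ diagDeriv (diagDeriv^[k] f) x ≠ 0} := by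
    rintro ζ ⟨hζ, hPζ⟩
    set x : Fin (m + 1) → ℝ := fun i => (ζ i).arg with hx
    have hxζ : ∀ i, Complex.exp (x i * Complex.I) = ζ i := fun i => by
      have := Complex.norm_mul_exp_arg_mul_I (ζ i)
      rwa [hζ i, Complex.ofReal_one, one_mul] at this
    have hfx : f x = 0 := by
      simp only [hf, hxζ]
      exact hPζ
    refine ⟨x, ?_, ?_⟩
    · have hg : slicePoly P (fun i => ζ i) ≠ 0 := by
        intro h0
        have := eval_slicePoly P (fun i => ζ i) 0
        rw [h0, zero_smul, Polynomial.eval_zero] at this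
        exact hP this.symm
      obtain ⟨k, hk⟩ := exists_iterate_X_mul_derivative_eval_ne_zero hg
      obtain ⟨c, hc, hck⟩ := iterate_diagDeriv_eq hfsm (x := x) one_ne_zero
        (g := slicePoly P (fun i => ζ i)) (fun t => by
          rw [one_mul, eval_slicePoly]
          simp only [hf]
          congr 2
          funext i
          simp only [Pi.add_apply, Pi.smul_apply, Pi.one_apply, smul_eq_mul, mul_one,
            Complex.ofReal_add, add_mul, Complex.exp_add, hxζ]
          ring) k
      have hex : ∃ k, diagDeriv^[k] f x ≠ 0 := ⟨k, by rw [hck]; exact mul_ne_zero hc hk⟩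
      classical
      obtain ⟨j, hj⟩ : ∃ j, Nat.find hex = j + 1 := Nat.exists_eq_succ_of_ne_zero fun h0 => by
        have := Nat.find_spec hex
        rw [h0] at this
        exact this hfx
      refine Set.mem_iUnion.2 ⟨j, ?_, ?_⟩
      · exact not_not.1 (Nat.find_min hex (m := j) (by omega))
      · have := Nat.find_spec hex
        rwa [hj, Function.iterate_succ_apply'] at this
    · ext i
      exact hxζ i
  calc dimH _ ≤ _ := dimH_mono hsub
    _ ≤ dimH (⋃ k : ℕ, {x | diagDeriv^[k] f x = 0 ∧ diagDeriv (diagDeriv^[k] f) x ≠ 0}) :=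
        hsm.contDiffOn.dimH_image_le convex_univ (Set.subset_univ _)
    _ ≤ m := by
        rw [dimH_iUnion]
        exact iSup_le fun k => dimH_regular_zeros_le (hfsm.iterate_diagDeriv k)

/-- The point of the right half of the unit circle with imaginary part `t ∈ [-1, 1]`. -/
def circleArc (t : ℝ) : ℂ := ⟨√(1 - t ^ 2), t⟩

theorem circleArc_zero : circleArc 0 = 1 := by
  simp [circleArc, Complex.ext_iff]

theorem continuous_circleArc : Continuous circleArc := by
  have : circleArc = fun t : ℝ => ((√(1 - t ^ 2) : ℝ) : ℂ) + t * Complex.I := by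
    funext t
    simp [circleArc, Complex.ext_iff]
  rw [this]
  fun_prop

theorem norm_circleArc {t : ℝ} (ht : |t| ≤ 1) : ‖circleArc t‖ = 1 := by
  have h : 0 ≤ 1 - t ^ 2 := by
    have := (sq_le_one_iff_abs_le_one t).2 ht
    linarith
  rw [← sq_eq_sq₀ (norm_nonneg _) zero_le_one, Complex.sq_norm, Complex.normSq_apply]
  simp only [circleArc]
  rw [Real.mul_self_sqrt h]
  ring

theorem mul_starRingEnd_of_norm_eq_one {z : ℂ} (hz : ‖z‖ = 1) : z * starRingEnd ℂ z = 1 := by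
  rw [Complex.mul_conj, Complex.normSq_eq_norm_sq, hz]
  simp

/-- The local parametrization of the unit torus around the point `ζ`. -/
def torusChart {ι : Type*} (ζ : ι → ℂ) (t : ι → ℝ) : ι → ℂ := fun i => ζ i * circleArc (t i)

theorem continuous_torusChart {ι : Type*} (ζ : ι → ℂ) : Continuous (torusChart ζ) :=
  continuous_pi fun i => continuous_const.mul (continuous_circleArc.comp (continuous_apply i))

theorem torusChart_zero {ι : Type*} (ζ : ι → ℂ) : torusChart ζ 0 = ζ := by
  funext i
  simp [torusChart, circleArc_zero]

theorem norm_torusChart {ι : Type*} {ζ : ι → ℂ} (hζ : ∀ i, ‖ζ i‖ = 1) {t : ι → ℝ}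
    (ht : ∀ i, |t i| ≤ 1) (i : ι) : ‖torusChart ζ t i‖ = 1 := by
  rw [torusChart, norm_mul, hζ, norm_circleArc (ht i), one_mul]

theorem eventually_abs_apply_le_one {ι : Type*} [Fintype ι] :
    ∀ᶠ t : ι → ℝ in nhds 0, ∀ i, |t i| ≤ 1 := by
  filter_upwards [Metric.closedBall_mem_nhds (0 : ι → ℝ) one_pos] with t ht i
  rw [mem_closedBall_zero_iff] at ht
  exact (norm_le_pi_norm t i).trans ht

/-- A nonzero polynomial does not vanish identically on any open piece of the unit torus. -/
theorem exists_torus_eval_ne_zero {ι : Type*} [Fintype ι] {r : MvPolynomial ι ℂ} (hr : r ≠ 0)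
    {ζ : ι → ℂ} (hζ : ∀ i, ‖ζ i‖ = 1) {W : Set (ι → ℂ)} (hW : W ∈ nhds ζ) :
    ∃ ω ∈ W, (∀ i, ‖ω i‖ = 1) ∧ MvPolynomial.eval ω r ≠ 0 := by
  by_contra! hcon
  have hev : ∀ᶠ t : ι → ℝ in nhds 0, torusChart ζ t ∈ W :=
    (continuous_torusChart ζ).continuousAt.eventually_mem (by rwa [torusChart_zero])
  obtain ⟨δ, hδ, hball⟩ := Metric.eventually_nhds_iff_ball.1
    (hev.and eventually_abs_apply_le_one)
  refine hr (MvPolynomial.funext_set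
    (fun i => (fun t => ζ i * circleArc t) '' Set.Ioo (-δ) δ) (fun i => ?_) fun x hx => ?_)
  · refine (Set.Ioo_infinite (by linarith)).image (Function.Injective.injOn fun s t hst => ?_)
    have h0 : ζ i ≠ 0 := by
      rw [← norm_ne_zero_iff, hζ]
      exact one_ne_zero
    exact congrArg Complex.im (mul_left_cancel₀ h0 hst)
  · choose t ht htx using fun i => hx i (Set.mem_univ i)
    have htb : t ∈ Metric.ball (0 : ι → ℝ) δ := by
      rw [mem_ball_zero_iff, pi_norm_lt_iff hδ]
      exact fun i => abs_lt.2 (ht i)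
    obtain rfl : torusChart ζ t = x := funext htx
    rw [hcon _ (hball t htb).1 (norm_torusChart hζ (hball t htb).2), map_zero]

/-- A set with a Lipschitz image containing an open subset of `ℝᵏ` has positive `k`-dimensional
Hausdorff measure. -/
theorem LipschitzOnWith.hausdorffMeasure_ne_zero {X : Type*} [MetricSpace X] [MeasurableSpace X]
    [BorelSpace X] {S : Set X} {k : ℕ} {F : X → Fin k → ℝ} {K : NNReal}
    (hF : LipschitzOnWith K F S) {y : Fin k → ℝ} (h : F '' S ∈ nhds y) : μH[(k : ℝ)] S ≠ 0 := by
  intro h0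
  have h1 := hF.hausdorffMeasure_image_le (d := k) k.cast_nonneg
  rw [h0, mul_zero, nonpos_iff_eq_zero] at h1
  have h2 : (μH[(k : ℝ)] : Measure (Fin k → ℝ)) = volume := by
    simpa using hausdorffMeasure_pi_real (ι := Fin k)
  rw [h2] at h1
  exact (Measure.measure_pos_of_mem_nhds volume h).ne' h1

theorem continuous_pEval {ι : Type*} [Fintype ι] (p : MvPolynomial ι ℂ) :
    Continuous (pEval p) :=
  (MvPolynomial.continuous_eval p).comp (PiLp.continuous_ofLp 2 _)

section RadialLimit

variable {n : ℕ} {p q : MvPolynomial (Fin n) ℂ} {φ : EuclideanSpace ℂ (Fin n) → ℂ}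

theorem smul_mem_polydisc {ζ : EuclideanSpace ℂ (Fin n)} (hζ : ζ ∈ torus (Fin n)) {ρ : ℝ}
    (hρ : ρ ∈ Set.Ioo 0 1) : (ρ : ℂ) • ζ ∈ polydisc n := by
  intro j
  rw [PiLp.smul_apply, norm_smul, hζ j, mul_one, Complex.norm_real, Real.norm_of_nonneg hρ.1.le]
  exact hρ.2

theorem tendsto_pEval_smul (p : MvPolynomial (Fin n) ℂ) (ζ : EuclideanSpace ℂ (Fin n)) :
    Tendsto (fun ρ : ℝ => pEval p ((ρ : ℂ) • ζ)) (nhdsWithin 1 (Set.Iio 1))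
      (nhds (pEval p ζ)) := by
  have h : Continuous fun ρ : ℝ => pEval p ((ρ : ℂ) • ζ) :=
    (continuous_pEval p).comp (Complex.continuous_ofReal.smul continuous_const)
  have h1 := (h.tendsto 1).mono_left (nhdsWithin_le_nhds (s := Set.Iio 1))
  simpa using h1

theorem IsRationalInner.pEval_eq_of_hasRadialLimit (hφ : IsRationalInner n p q φ)
    {ζ : EuclideanSpace ℂ (Fin n)} (hζ : ζ ∈ torus (Fin n)) {β : ℂ}
    (h : HasRadialLimit φ ζ β) : pEval p ζ = β * pEval q ζ := by
  refine tendsto_nhds_unique (tendsto_pEval_smul p ζ)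
    ((Tendsto.mul h (tendsto_pEval_smul q ζ)).congr' ?_)
  filter_upwards [Ioo_mem_nhdsLT (zero_lt_one' ℝ)] with ρ hρ
  have hz := smul_mem_polydisc hζ hρ
  rw [hφ.phi_eq _ hz, div_mul_cancel₀ _ (hφ.q_ne_zero _ hz)]

theorem IsRationalInner.hasRadialLimit (hφ : IsRationalInner n p q φ)
    {ζ : EuclideanSpace ℂ (Fin n)} (hζ : ζ ∈ torus (Fin n)) (hq : pEval q ζ ≠ 0) :
    HasRadialLimit φ ζ (pEval p ζ / pEval q ζ) := by
  refine ((tendsto_pEval_smul p ζ).div (tendsto_pEval_smul q ζ) hq).congr' ?_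
  filter_upwards [Ioo_mem_nhdsLT (zero_lt_one' ℝ)] with ρ hρ
  exact (hφ.phi_eq _ (smul_mem_polydisc hζ hρ)).symm

theorem IsRationalInner.norm_eval_lt (hφ : IsRationalInner n p q φ) (z : Fin n → ℂ)
    (hz : ∀ i, ‖z i‖ < 1) : ‖MvPolynomial.eval z p‖ < ‖MvPolynomial.eval z q‖ := by
  have hz' : WithLp.toLp 2 z ∈ polydisc n := hz
  have h1 := hφ.abs_lt_one _ hz'
  rw [hφ.phi_eq _ hz', norm_div, div_lt_one (norm_pos_iff.2 (hφ.q_ne_zero _ hz'))] at h1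
  exact h1

theorem IsRationalInner.norm_eval_eq (hφ : IsRationalInner n p q φ) (z : Fin n → ℂ)
    (hz : ∀ i, ‖z i‖ = 1) : ‖MvPolynomial.eval z p‖ = ‖MvPolynomial.eval z q‖ := by
  by_contra hne
  obtain ⟨E, -, hE0, hE⟩ := hφ.inner
  refine LipschitzOnWith.hausdorffMeasure_ne_zero (k := n) (y := 0) (K := 1)
    (F := fun w j => (w j * starRingEnd ℂ (z j)).im) (S := E) ?_ ?_ hE0
  · refine LipschitzOnWith.of_dist_le_mul fun v _ w _ => ?_
    rw [NNReal.coe_one, one_mul, dist_pi_le_iff dist_nonneg]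
    intro j
    rw [Real.dist_eq, ← Complex.sub_im, ← sub_mul]
    calc _ ≤ ‖(v j - w j) * starRingEnd ℂ (z j)‖ := Complex.abs_im_le_norm _
      _ = ‖(v - w) j‖ := by rw [norm_mul, RCLike.norm_conj, hz, mul_one, PiLp.sub_apply]
      _ ≤ dist v w := by rw [dist_eq_norm]; exact PiLp.norm_apply_le _ _
  · have hcont : Continuous fun t : Fin n → ℝ => ‖MvPolynomial.eval (torusChart z t) p‖ -
        ‖MvPolynomial.eval (torusChart z t) q‖ :=
      (((MvPolynomial.continuous_eval p).comp (continuous_torusChart z)).norm).sub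
        (((MvPolynomial.continuous_eval q).comp (continuous_torusChart z)).norm)
    have hev := hcont.continuousAt.eventually_ne (x := 0) (y := 0) (by
      rw [torusChart_zero]
      exact sub_ne_zero.2 hne)
    filter_upwards [hev, eventually_abs_apply_le_one] with t ht ht1
    have htorus : WithLp.toLp 2 (torusChart z t) ∈ torus (Fin n) := norm_torusChart hz ht1
    refine ⟨WithLp.toLp 2 (torusChart z t), ?_, ?_⟩
    · by_contra hmem
      obtain ⟨β, hβ, hlim⟩ := hE _ ⟨htorus, hmem⟩
      have h1 := hφ.pEval_eq_of_hasRadialLimit htorus hlim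
      have h2 := congrArg norm h1
      rw [norm_mul, hβ, one_mul] at h2
      exact ht (sub_eq_zero.2 h2)
    · funext j
      have : torusChart z t j * starRingEnd ℂ (z j) = circleArc (t j) := by
        rw [torusChart, mul_right_comm, mul_starRingEnd_of_norm_eq_one (hz j), one_mul]
      exact congrArg Complex.im this

theorem IsRationalInner.dim_ne_zero (hφ : IsRationalInner n p q φ) : n ≠ 0 := by
  rintro rfl
  exact (hφ.norm_eval_lt 0 fun i => i.elim0).ne (hφ.norm_eval_eq 0 fun i => i.elim0)

theorem pEval_sub_C_mul_eq_zero_iff {α : ℂ} {ζ : EuclideanSpace ℂ (Fin n)} :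
    pEval (p - MvPolynomial.C α * q) ζ = 0 ↔ pEval p ζ = α * pEval q ζ := by
  rw [pEval, map_sub, map_mul, MvPolynomial.eval_C, sub_eq_zero]
  rfl

theorem isClosed_torus : IsClosed (torus (Fin n)) := by
  rw [torus, Set.ofPred_forall]
  exact isClosed_iInter fun j => isClosed_eq (by fun_prop) continuous_const

theorem IsRationalInner.closure_radialFiber (hφ : IsRationalInner n p q φ) {α : ℂ}
    (hα : ‖α‖ = 1) :
    closure (radialFiber φ α) = {ζ | ζ ∈ torus (Fin n) ∧ pEval p ζ = α * pEval q ζ} := by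
  refine Set.Subset.antisymm (closure_minimal
    (fun ζ hζ => ⟨hζ.1, hφ.pEval_eq_of_hasRadialLimit hζ.1 hζ.2⟩)
    (isClosed_torus.inter (isClosed_eq (continuous_pEval p)
      (continuous_const.mul (continuous_pEval q))))) ?_
  rintro ζ ⟨hζ, hPζ⟩
  rw [mem_closure_iff_nhds]
  intro U hU
  have hq0 : MvPolynomial.eval (0 : Fin n → ℂ) q ≠ 0 :=
    norm_pos_iff.1 ((norm_nonneg _).trans_lt (hφ.norm_eval_lt 0 fun i => by simp))
  obtain ⟨r, a, b, hr, hab⟩ := exists_mul_add_mul_eq_C_of_forall_dvd (diagPoly_ne_zero hq0)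
    (diagPoly_common_dvd_natDegree hφ.coprime hq0)
  have hcont : ContinuousAt (fun x : ℂ × (Fin n → ℂ) =>
      (WithLp.toLp 2 (x.1 • x.2) : EuclideanSpace ℂ (Fin n))) (1, fun i => ζ i) :=
    ((PiLp.continuous_toLp 2 _).comp (continuous_fst.smul continuous_snd)).continuousAt
  have hU' : U ∈ nhds (WithLp.toLp 2 ((1 : ℂ) • fun i => ζ i) : EuclideanSpace ℂ (Fin n)) := by
    rw [one_smul]
    exact hU
  obtain ⟨A, hA, B, hB, hAB⟩ := mem_nhds_prod_iff.1 (hcont.eventually_mem hU')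
  obtain ⟨ε, hε, hεA⟩ := Metric.mem_nhds_iff.1 hA
  have hev := eventually_exists_eval_smul_eq_zero hφ.coprime hφ.norm_eval_lt hφ.norm_eval_eq hα
    (pEval_sub_C_mul_eq_zero_iff.2 hPζ) hε
  obtain ⟨ω, ⟨hωB, hωs⟩, hω, hrω⟩ := exists_torus_eval_ne_zero hr hζ (Filter.inter_mem hB hev)
  obtain ⟨s, hs, hs1, hPs⟩ := hωs hω
  have hmem : (WithLp.toLp 2 (s • ω) : EuclideanSpace ℂ (Fin n)) ∈ torus (Fin n) := fun i => by
    change ‖s * ω i‖ = 1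
    rw [norm_mul, hs, hω, one_mul]
  have hPs' := pEval_sub_C_mul_eq_zero_iff.1
    (show pEval (p - MvPolynomial.C α * q) (WithLp.toLp 2 (s • ω)) = 0 from hPs)
  have hqs : pEval q (WithLp.toLp 2 (s • ω)) ≠ 0 := by
    intro hq
    rw [hq, mul_zero] at hPs'
    have h1 := congrArg (fun g => (g.map (MvPolynomial.eval ω)).eval s) hab
    simp only [Polynomial.map_add, Polynomial.map_mul, Polynomial.eval_add, Polynomial.eval_mul,
      Polynomial.map_C, Polynomial.eval_C] at h1
    have h2 : ((diagPoly p).map (MvPolynomial.eval ω)).eval s = 0 :=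
      (eval_slicePoly p ω s).trans hPs'
    have h3 : ((diagPoly q).map (MvPolynomial.eval ω)).eval s = 0 :=
      (eval_slicePoly q ω s).trans hq
    rw [h2, h3, zero_mul, zero_mul, add_zero] at h1
    exact hrω h1.symm
  refine ⟨WithLp.toLp 2 (s • ω), hAB (Set.mk_mem_prod (hεA ?_) hωB), hmem, ?_⟩
  · rwa [Metric.mem_ball, dist_comm, dist_eq_norm]
  · have := hφ.hasRadialLimit hmem hqs
    rwa [hPs', mul_div_cancel_right₀ _ hqs] at this

end RadialLimit

theorem IsRationalInner.hausdorffMeasure_ne_zero {m : ℕ} {p q : MvPolynomial (Fin (m + 1)) ℂ}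
    {φ : EuclideanSpace ℂ (Fin (m + 1)) → ℂ} (hφ : IsRationalInner (m + 1) p q φ) {α : ℂ}
    (hα : ‖α‖ = 1) :
    μH[(m : ℝ)] {ζ | ζ ∈ torus (Fin (m + 1)) ∧ pEval p ζ = α * pEval q ζ} ≠ 0 := by
  refine LipschitzOnWith.hausdorffMeasure_ne_zero (k := m) (y := 0) (K := 2)
    (F := fun w j => (w j.succ * starRingEnd ℂ (w 0)).im) ?_ ?_
  · refine LipschitzOnWith.of_dist_le_mul fun v hv w hw => ?_
    rw [dist_pi_le_iff (by positivity)]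
    intro j
    rw [Real.dist_eq, ← Complex.sub_im]
    have hle : ∀ i, ‖v i - w i‖ ≤ dist v w := fun i => by
      rw [dist_eq_norm, ← PiLp.sub_apply]
      exact PiLp.norm_apply_le _ _
    calc _ ≤ ‖v j.succ * starRingEnd ℂ (v 0) - w j.succ * starRingEnd ℂ (w 0)‖ :=
          Complex.abs_im_le_norm _
      _ = ‖(v j.succ - w j.succ) * starRingEnd ℂ (v 0) +
            w j.succ * starRingEnd ℂ (v 0 - w 0)‖ := by rw [map_sub]; ring_nf
      _ ≤ ‖v j.succ - w j.succ‖ + ‖v 0 - w 0‖ := by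
          refine (norm_add_le _ _).trans_eq ?_
          rw [norm_mul, norm_mul, RCLike.norm_conj, RCLike.norm_conj, hv.1, hw.1, mul_one,
            one_mul]
      _ ≤ ((2 : NNReal) : ℝ) * dist v w := by
          have h1 := hle j.succ
          have h2 := hle 0
          rw [NNReal.coe_ofNat]
          linarith
  · filter_upwards [eventually_abs_apply_le_one] with t ht
    set ω : Fin (m + 1) → ℂ := Fin.cons 1 fun j => circleArc (t j)
    have hω : ∀ i, ‖ω i‖ = 1 := fun i =>
      Fin.cases (by simp [ω]) (fun j => by simp [ω, norm_circleArc (ht j)]) i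
    obtain ⟨s, hs, hPs⟩ := exists_eval_smul_eq_zero hφ.coprime hφ.norm_eval_lt hφ.norm_eval_eq hα hω
    refine ⟨WithLp.toLp 2 (s • ω), ⟨fun i => ?_, pEval_sub_C_mul_eq_zero_iff.1 hPs⟩, ?_⟩
    · change ‖s * ω i‖ = 1
      rw [norm_mul, hs, hω, one_mul]
    · funext j
      have : s * ω j.succ * starRingEnd ℂ (s * ω 0) = circleArc (t j) := by
        simp only [ω, Fin.cons_succ, Fin.cons_zero, mul_one]
        rw [mul_right_comm, mul_starRingEnd_of_norm_eq_one hs, one_mul]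
      exact congrArg Complex.im this

/-- The closure of `φ₁⁻¹(α)` is the algebraic set `V_α = {ζ ∈ 𝕋ⁿ : p(ζ) = α q(ζ)}`, which has
Hausdorff dimension `n - 1` and positive `ℋ^{n-1}`-measure. -/
theorem closure_radialFiber_eq {n : ℕ} (p q : MvPolynomial (Fin n) ℂ)
    (φ : EuclideanSpace ℂ (Fin n) → ℂ) (hφ : IsRationalInner n p q φ)
    (α : ℂ) (hα : ‖α‖ = 1)
    (Vα : Set (EuclideanSpace ℂ (Fin n)))
    (hVα : Vα = {ζ | ζ ∈ torus (Fin n) ∧ pEval p ζ = α * pEval q ζ}) :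
    closure (radialFiber φ α) = Vα ∧ dimH Vα = (n : ℝ≥0∞) - 1 ∧ 0 < μH[(n : ℝ) - 1] Vα := by
  subst hVα
  obtain ⟨m, rfl⟩ := Nat.exists_eq_succ_of_ne_zero hφ.dim_ne_zero
  have hpos := hφ.hausdorffMeasure_ne_zero hα
  have hr : ((m.succ : ℕ) : ℝ) - 1 = m := by
    rw [Nat.cast_succ, add_sub_cancel_right]
  have he : ((m.succ : ℕ) : ℝ≥0∞) - 1 = m := by
    rw [Nat.cast_succ, ENNReal.add_sub_cancel_right ENNReal.one_ne_top]
  rw [hr, he]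
  refine ⟨hφ.closure_radialFiber hα, le_antisymm ?_ ?_, pos_iff_ne_zero.2 hpos⟩
  · have h := dimH_torus_zeros_le (P := p - MvPolynomial.C α * q)
      (eval_sub_ne_zero_of_norm_lt_one hφ.norm_eval_lt hα fun i => by simp)
    simpa only [pEval_sub_C_mul_eq_zero_iff] using h
  · exact_mod_cast le_dimH_of_hausdorffMeasure_ne_zero (d := m) (by exact_mod_cast hpos)

end
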